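/- arXiv:math/0612277 — 2 statements merged into one kernel-verified Lean document; each statement's English description precedes it below -/
import Mathlib

section
/- For j ≥ 2 let s_j be the pattern (j−1)(j−2) ⋯ 2 1 (j+1) j of length j+1 (i.e. s_j(i) = j−i for 1 ≤ i ≤ j−1, s_j(j) = j+1, s_j(j+1) = j), and let G_j(x) = ∑_{n≥0} |S_n(123, s_j)| x^n be the generating function, in ℤ⟦x⟧, of the numbers of permutations of {1,…,n} avoiding both 123 and s_j. Then for every k ≥ 4, G_k(x)·(1 − x·G_{k−1}(x)) = 1, i.e. G_k(x) = 1/(1 − x G_{k−1}(x)). -/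
/-- A permutation `σ` of `{1,…,n}` contains the pattern `τ` (given in one-line
notation as a function `Fin k → ℕ`) if there is a strictly increasing choice of
indices along which `σ` is order-isomorphic to `τ`. -/
def Contains {n k : ℕ} (σ : Equiv.Perm (Fin n)) (τ : Fin k → ℕ) : Prop :=
  ∃ f : Fin k → Fin n, StrictMono f ∧ ∀ a b : Fin k, σ (f a) < σ (f b) ↔ τ a < τ b

/-- `σ` avoids the pattern `τ`. -/
def Avoids {n k : ℕ} (σ : Equiv.Perm (Fin n)) (τ : Fin k → ℕ) : Prop :=
  ¬ Contains σ τ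

def p123 : Fin 3 → ℕ := ![1, 2, 3]
def p132 : Fin 3 → ℕ := ![1, 3, 2]
def p213 : Fin 3 → ℕ := ![2, 1, 3]
def p1432 : Fin 4 → ℕ := ![1, 4, 3, 2]
def p3214 : Fin 4 → ℕ := ![3, 2, 1, 4]
def p2143 : Fin 4 → ℕ := ![2, 1, 4, 3]

/-- The pattern `q_k = 1 (k+1) k (k-1) ⋯ 2` of length `k+1` (one-line notation,
position `j` is 0-indexed here, values 1-indexed). -/
def qpat (k : ℕ) : Fin (k + 1) → ℕ := fun j => if j.val = 0 then 1 else k + 2 - j.val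

/-- The pattern `r_k = k (k-1) ⋯ 2 1 (k+1)` of length `k+1`. -/
def rpat (k : ℕ) : Fin (k + 1) → ℕ := fun j => if j.val = k then k + 1 else k - j.val

/-- The pattern `s_k = (k-1)(k-2) ⋯ 2 1 (k+1) k` of length `k+1`. -/
def spat (k : ℕ) : Fin (k + 1) → ℕ := fun j =>
  if j.val = k - 1 then k + 1 else if j.val = k then k else k - 1 - j.val

/-- The pattern `u_k = 2 1 (k+1) k (k-1) ⋯ 4 3` of length `k+1`. -/
def upat (k : ℕ) : Fin (k + 1) → ℕ := fun j =>
  if j.val = 0 then 2 else if j.val = 1 then 1 else k + 3 - j.val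


open Finset

/-- Counting function of the generating tree. -/
def treeW (K : ℕ) : ℕ → ℕ → ℕ
  | 0, _ => 1
  | n + 1, c => treeW K n (c + 1) + ∑ p ∈ Finset.range c, treeW K n (min (p + 1) K)

noncomputable def treeF (K c : ℕ) : PowerSeries ℤ := PowerSeries.mk fun n => (treeW K n c : ℤ)

noncomputable def denP : ℕ → PowerSeries ℤ
  | 0 => 1 - PowerSeries.X
  | 1 => 1 - 2 * PowerSeries.X
  | j + 2 => denP (j + 1) - PowerSeries.X * denP j

theorem denP_const (j : ℕ) : PowerSeries.constantCoeff (denP j) = 1 := by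
  induction j using denP.induct with
  | case1 => simp [denP]
  | case2 => simp [denP]
  | case3 j h1 h2 => simp [denP, h1]

theorem denP_ne (j : ℕ) : denP j ≠ 0 := by
  intro h
  have := denP_const j
  simp [h] at this

theorem treeF_eq (K c : ℕ) : treeF K c = 1 + PowerSeries.X *
    (treeF K (c + 1) + ∑ p ∈ Finset.range c, treeF K (min (p + 1) K)) := by
  ext n
  cases n with
  | zero => simp [treeF, treeW]
  | succ n =>
    rw [map_add, PowerSeries.coeff_succ_X_mul]
    simp [treeF, treeW, PowerSeries.coeff_one]

theorem treeF_diff (K c : ℕ) : treeF K (c + 1) - treeF K c =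
    PowerSeries.X * (treeF K (c + 2) - treeF K (c + 1) + treeF K (min (c + 1) K)) := by
  have h1 := treeF_eq K c
  have h2 := treeF_eq K (c + 1)
  rw [Finset.sum_range_succ] at h2
  linear_combination h2 - h1

theorem treeF_const_diff (K n : ℕ) : ∀ c, K ≤ c + 1 →
    PowerSeries.coeff n (treeF K (c + 1) - treeF K c) =
    PowerSeries.coeff n (treeF K (c + 2) - treeF K (c + 1)) := by
  induction n with
  | zero => intro c _; simp [treeF, treeW]
  | succ n ih =>
    intro c hc
    have h1 := treeF_diff K c
    have h2 := treeF_diff K (c + 1)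
    have h3 := ih (c + 1) (by omega)
    rw [min_eq_right hc] at h1
    rw [min_eq_right (by omega : K ≤ c + 1 + 1)] at h2
    change treeF K (c + 2) - treeF K (c + 1) = _ at h2
    have e1 := congrArg (PowerSeries.coeff (n + 1)) h1
    have e2 := congrArg (PowerSeries.coeff (n + 1)) h2
    rw [PowerSeries.coeff_succ_X_mul, map_add] at e1 e2
    rw [e1, e2]
    exact congrArg (· + _) h3

theorem treeF_top (K c : ℕ) (hc : K ≤ c + 1) :
    (1 - PowerSeries.X) * (treeF K (c + 1) - treeF K c) = PowerSeries.X * treeF K K := by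
  have h := treeF_diff K c
  have h2 : treeF K (c + 1) - treeF K c = treeF K (c + 2) - treeF K (c + 1) := by
    ext n; exact treeF_const_diff K n c hc
  rw [min_eq_right hc, ← h2] at h
  linear_combination h

theorem treeF_denP (K : ℕ) : ∀ j, j ≤ K →
    (1 - PowerSeries.X) * treeF K (K - j) = denP j * treeF K K := by
  intro j
  induction j using denP.induct with
  | case1 => simp [denP]
  | case2 =>
    intro h
    have := treeF_top K (K - 1) (by omega)
    rw [show K - 1 + 1 = K by omega] at this
    simp only [denP]
    linear_combination -this
  | case3 j h1 h2 =>
    intro h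
    have h1 := h1 (by omega)
    have h2 := h2 (by omega)
    have := treeF_diff K (K - (j + 2))
    rw [show K - (j + 2) + 1 = K - (j + 1) by omega, show K - (j + 2) + 2 = K - j by omega,
      min_eq_left (by omega)] at this
    simp only [denP]
    linear_combination h1 - PowerSeries.X * h2 - (1 - PowerSeries.X) * this

theorem treeF_zero (K : ℕ) (hK : 1 ≤ K) : treeF K 0 * denP (K + 1) = denP K := by
  obtain ⟨K, rfl⟩ : ∃ L, K = L + 1 := ⟨K - 1, by omega⟩
  have h0 := treeF_denP (K + 1) (K + 1) le_rfl
  have h1 := treeF_denP (K + 1) K (by omega)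
  rw [show K + 1 - (K + 1) = 0 by omega] at h0
  rw [show K + 1 - K = 1 by omega] at h1
  have h2 := treeF_eq (K + 1) 0
  simp only [zero_add, Finset.range_zero, Finset.sum_empty, add_zero] at h2
  have h3 : denP (K + 2) * treeF (K + 1) (K + 1) = 1 - PowerSeries.X := by
    simp only [denP]
    linear_combination (1 - PowerSeries.X) * h2 - h0 + PowerSeries.X * h1
  apply mul_left_cancel₀ (denP_ne 0)
  simp only [denP] at h3 ⊢
  linear_combination (denP (K + 1) - PowerSeries.X * denP K) * h0 + denP (K + 1) * h3

theorem treeF_rec (K : ℕ) (hK : 2 ≤ K) :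
    treeF K 0 * (1 - PowerSeries.X * treeF (K - 1) 0) = 1 := by
  obtain ⟨K, rfl⟩ : ∃ L, K = L + 2 := ⟨K - 2, by omega⟩
  have h1 := treeF_zero (K + 2) (by omega)
  have h2 := treeF_zero (K + 1) (by omega)
  rw [show K + 2 - 1 = K + 1 by omega]
  apply mul_left_cancel₀ (mul_ne_zero (denP_ne (K + 3)) (denP_ne (K + 2)))
  have h3 : denP (K + 3) = denP (K + 2) - PowerSeries.X * denP (K + 1) := rfl
  linear_combination (denP (K+2) * (1 - PowerSeries.X * treeF (K + 1) 0)) * h1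
    - denP (K+2) * PowerSeries.X * h2 - denP (K+2) * h3

open Finset

def AvK (K : ℕ) {n : ℕ} (σ : Equiv.Perm (Fin n)) : Prop :=
  (∀ i j l, i < j → j < l → σ i < σ j → ¬ σ j < σ l) ∧
  ∀ q l, q < l → σ l < σ q → (univ.filter fun i => i < q ∧ σ i < σ l).card ≤ K

def GoodK (K : ℕ) {n : ℕ} (v : ℕ) (π : Equiv.Perm (Fin n)) : Prop :=
  v ≤ n ∧ (∀ i j, i < j → π i < π j → ¬ (π j).val < v) ∧
  ∀ q, v ≤ (π q).val → (univ.filter fun i => i < q ∧ (π i).val < v).card ≤ K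

theorem contains123_iff {n : ℕ} (σ : Equiv.Perm (Fin n)) :
    Avoids σ p123 ↔ ∀ i j l, i < j → j < l → σ i < σ j → ¬ σ j < σ l := by
  constructor
  · intro h i j l hij hjl h1 h2
    apply h
    have h3 := h1.trans h2
    refine ⟨![i, j, l], ?_, ?_⟩
    · rw [Fin.strictMono_iff_lt_succ]
      intro a
      fin_cases a <;> simpa
    · intro a b
      fin_cases a <;> fin_cases b <;> simp [p123] <;> first | exact h1 | exact h2 | exact h3 | exact h1.le | exact h2.le | exact h3.le
  · rintro h ⟨f, hf, hp⟩
    refine h (f 0) (f 1) (f 2) (hf (by decide)) (hf (by decide)) ?_ ?_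
    · rw [hp]; simp [p123]
    · rw [hp]; simp [p123]

theorem avoids_iff {n : ℕ} (K : ℕ) (σ : Equiv.Perm (Fin n)) :
    (Avoids σ p123 ∧ Avoids σ (spat (K + 2))) ↔ AvK K σ := by
  rw [contains123_iff]
  refine and_congr_right fun h => ?_
  constructor
  · intro hs q l hql hσ
    by_contra hc
    push Not at hc
    apply hs
    obtain ⟨S, hS, hcard⟩ := Finset.exists_subset_card_eq (Nat.succ_le_of_lt hc)
    have hmem : ∀ i ∈ S, i < q ∧ σ i < σ l := fun i hi => by simpa using hS hi
    let e := S.orderEmbOfFin hcard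
    have he : ∀ a, e a < q ∧ σ (e a) < σ l := fun a => hmem _ (S.orderEmbOfFin_mem hcard a)
    have hanti : ∀ a b, a < b → σ (e b) < σ (e a) := by
      intro a b hab
      have h1 : e a < e b := e.strictMono hab
      rcases lt_trichotomy (σ (e a)) (σ (e b)) with h2 | h2 | h2
      · exact absurd (he b).2 (h _ _ l h1 ((he b).1.trans hql) h2)
      · exact absurd (σ.injective h2) h1.ne
      · exact h2
    let f : Fin (K + 2 + 1) → Fin n := fun a =>
      if ha : a.val < K + 1 then e ⟨a.val, ha⟩ else if a.val = K + 1 then q else l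
    refine ⟨f, ?_, ?_⟩
    · intro a b hab
      have hab' : a.val < b.val := hab
      have hb := b.isLt
      simp only [f]
      split_ifs with h1 h2 h3 h4 h5 h6
      all_goals first
        | exact e.strictMono hab
        | exact (he _).1
        | exact (he _).1.trans hql
        | exact hql
        | (exfalso; omega)
    · intro a b
      have ha := a.isLt
      have hb := b.isLt
      simp only [f, spat]
      split_ifs
      all_goals try (exfalso; omega)
      · constructor
        · intro hlt
          have : ¬ (a.val ≤ b.val) := by
            intro hle
            rcases hle.lt_or_eq with h1 | h1
            · exact absurd hlt (hanti ⟨a.val, by omega⟩ ⟨b.val, by omega⟩ h1).not_gt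
            · simp [h1] at hlt
          omega
        · intro hlt
          exact hanti _ _ (show b.val < a.val by omega)
      all_goals first
        | exact iff_of_true ((he _).2.trans hσ) (by omega)
        | exact iff_of_true (he _).2 (by omega)
        | exact iff_of_true hσ (by omega)
        | exact iff_of_false ((he _).2.trans hσ).not_gt (by omega)
        | exact iff_of_false (he _).2.not_gt (by omega)
        | exact iff_of_false hσ.not_gt (by omega)
        | exact iff_of_false (lt_irrefl _) (by omega)
  · rintro hs ⟨f, hf, hp⟩
    have hc := hs (f ⟨K + 1, by omega⟩) (f ⟨K + 2, by omega⟩) (hf (by simp))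
      (by rw [hp]; simp [spat])
    have : (univ : Finset (Fin (K + 1))).card ≤ (univ.filter fun i => i < f ⟨K + 1, by omega⟩ ∧
        σ i < σ (f ⟨K + 2, by omega⟩)).card := by
      apply Finset.card_le_card_of_injOn (fun a => f ⟨a.val, by omega⟩)
      · intro a _
        have := a.isLt
        simp only [coe_filter, mem_univ, true_and, Set.mem_ofPred_eq]
        refine ⟨hf (by simp only [Fin.lt_def]; omega), ?_⟩
        rw [hp]
        simp only [spat]
        split_ifs <;> omega
      · intro a _ b _ hab
        have := hf.injective hab
        simpa [Fin.ext_iff] using this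
    simp at this
    omega

/-- insert a new last entry with value `v` -/
def insLast {n : ℕ} (v : Fin (n + 1)) (π : Equiv.Perm (Fin n)) : Equiv.Perm (Fin (n + 1)) :=
  (finSuccEquivLast.trans (Equiv.optionCongr π)).trans (finSuccEquiv' v).symm

theorem insLast_last {n : ℕ} (v : Fin (n + 1)) (π : Equiv.Perm (Fin n)) :
    insLast v π (Fin.last n) = v := by
  simp [insLast]

theorem insLast_castSucc {n : ℕ} (v : Fin (n + 1)) (π : Equiv.Perm (Fin n)) (i : Fin n) :
    insLast v π i.castSucc = v.succAbove (π i) := by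
  simp [insLast]

theorem insLast_val {n : ℕ} (v : Fin (n + 1)) (π : Equiv.Perm (Fin n)) (i : Fin n) :
    (insLast v π i.castSucc).val = if (π i).val < v.val then (π i).val else (π i).val + 1 := by
  rw [insLast_castSucc, Fin.succAbove]
  simp only [Fin.lt_def, Fin.val_castSucc]
  split_ifs <;> simp

theorem insLast_bij (n : ℕ) : Function.Bijective
    (fun x : Fin (n + 1) × Equiv.Perm (Fin n) => insLast x.1 x.2) := by
  rw [Fintype.bijective_iff_injective_and_card]
  constructor
  · rintro ⟨v, π⟩ ⟨w, ρ⟩ h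
    simp only at h
    have h1 : v = w := by
      have := congrArg (fun e => e (Fin.last n)) h
      simpa [insLast_last] using this
    subst h1
    congr 1
    ext i
    have := congrArg (fun e => e i.castSucc) h
    simp only [insLast_castSucc] at this
    rw [Fin.succAbove_right_injective this]
  · simp [Fintype.card_perm, Nat.factorial_succ]

theorem card_castSucc {n : ℕ} (q : Fin n) (P : Fin (n + 1) → Prop) [DecidablePred P] :
    (univ.filter fun i => i < q.castSucc ∧ P i).card =
    (univ.filter fun i : Fin n => i < q ∧ P i.castSucc).card := by
  rw [← Finset.card_map Fin.castSuccEmb (s := univ.filter fun i : Fin n => _)]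
  refine congrArg Finset.card ?_
  ext i
  refine Fin.lastCases ?_ (fun j => ?_) i
  · simp [Fin.le_last, Fin.castSucc_ne_last]
  · simp

theorem card_lastPos {n : ℕ} (P : Fin (n + 1) → Prop) [DecidablePred P] :
    (univ.filter fun i => i < Fin.last n ∧ P i).card =
    (univ.filter fun i : Fin n => P i.castSucc).card := by
  rw [← Finset.card_map Fin.castSuccEmb (s := univ.filter fun i : Fin n => _)]
  refine congrArg Finset.card ?_
  ext i
  refine Fin.lastCases ?_ (fun j => ?_) i
  · simp [Fin.castSucc_ne_last]
  · simp [Fin.castSucc_lt_last]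

theorem insLast_lt {n : ℕ} (v : Fin (n + 1)) (π : Equiv.Perm (Fin n)) (i j : Fin n) :
    insLast v π i.castSucc < insLast v π j.castSucc ↔ π i < π j := by
  simp [insLast_castSucc]

theorem insLast_lt_last {n : ℕ} (v : Fin (n + 1)) (π : Equiv.Perm (Fin n)) (i : Fin n) :
    insLast v π i.castSucc < insLast v π (Fin.last n) ↔ (π i).val < v.val := by
  rw [Fin.lt_def, insLast_val, insLast_last]
  split_ifs <;> omega

theorem last_lt_insLast {n : ℕ} (v : Fin (n + 1)) (π : Equiv.Perm (Fin n)) (i : Fin n) :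
    insLast v π (Fin.last n) < insLast v π i.castSucc ↔ v.val ≤ (π i).val := by
  rw [Fin.lt_def, insLast_val, insLast_last]
  split_ifs <;> omega

theorem avK_insLast {n : ℕ} (K : ℕ) (v : Fin (n + 1)) (π : Equiv.Perm (Fin n)) :
    AvK K (insLast v π) ↔ AvK K π ∧ GoodK K v.val π := by
  constructor
  · rintro ⟨h1, h2⟩
    refine ⟨⟨?_, ?_⟩, by omega, ?_, ?_⟩
    · intro i j l hij hjl a b
      exact h1 i.castSucc j.castSucc l.castSucc (by simpa) (by simpa)
        ((insLast_lt ..).2 a) ((insLast_lt ..).2 b)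
    · intro q l hql a
      have := h2 q.castSucc l.castSucc (by simpa) ((insLast_lt ..).2 a)
      rw [card_castSucc] at this
      simpa only [insLast_lt] using this
    · intro i j hij a b
      exact h1 i.castSucc j.castSucc (Fin.last n) (by simpa) (Fin.castSucc_lt_last j)
        ((insLast_lt ..).2 a) ((insLast_lt_last ..).2 b)
    · intro q hq
      have := h2 q.castSucc (Fin.last n) (Fin.castSucc_lt_last q) ((last_lt_insLast ..).2 hq)
      rw [card_castSucc] at this
      simpa only [insLast_lt_last] using this
  · rintro ⟨⟨h1, h2⟩, -, h3, h4⟩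
    refine ⟨?_, ?_⟩
    · intro i j l hij hjl
      obtain ⟨j, rfl⟩ : ∃ j', j = Fin.castSucc j' := Fin.exists_castSucc_eq.2 (hjl.trans_le (Fin.le_last l)).ne |>.imp fun _ h => h.symm
      obtain ⟨i, rfl⟩ : ∃ j', i = Fin.castSucc j' := Fin.exists_castSucc_eq.2 (hij.trans_le (Fin.le_last _)).ne |>.imp fun _ h => h.symm
      revert hjl
      refine Fin.lastCases ?_ (fun l => ?_) l
      · rw [insLast_lt, insLast_lt_last]
        exact fun _ a => h3 i j (by simpa using hij) a
      · rw [insLast_lt, insLast_lt]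
        exact fun hjl a => h1 i j l (by simpa using hij) (by simpa using hjl) a
    · intro q l hql
      obtain ⟨q, rfl⟩ : ∃ j', q = Fin.castSucc j' := Fin.exists_castSucc_eq.2 (hql.trans_le (Fin.le_last l)).ne |>.imp fun _ h => h.symm
      rw [card_castSucc]
      revert hql
      refine Fin.lastCases ?_ (fun l => ?_) l
      · simp only [insLast_lt_last, last_lt_insLast]
        exact fun _ a => h4 q a
      · simp only [insLast_lt]
        exact fun hql a => h2 q l (by simpa using hql) a

theorem goodK_zero (K : ℕ) {n : ℕ} (π : Equiv.Perm (Fin n)) : GoodK K 0 π := by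
  simp [GoodK]

theorem goodK_mono (K : ℕ) {n : ℕ} (π : Equiv.Perm (Fin n)) {v w : ℕ} (h : GoodK K v π)
    (hw : w ≤ v) : GoodK K w π := by
  obtain ⟨h1, h2, h3⟩ := h
  refine ⟨by omega, fun i j hij a b => h2 i j hij a (by omega), fun q hq => ?_⟩
  by_cases hv : v ≤ (π q).val
  · refine le_trans (Finset.card_le_card ?_) (h3 q hv)
    intro i
    simp only [mem_filter, mem_univ, true_and]
    exact fun h => ⟨h.1, by omega⟩
  · rw [Finset.card_eq_zero.2]
    · omega
    · rw [Finset.filter_eq_empty_iff]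
      rintro i - ⟨hi, hi2⟩
      exact h2 i q hi (Fin.lt_def.2 (by omega)) (by omega)

theorem exists_label (K : ℕ) {n : ℕ} (π : Equiv.Perm (Fin n)) :
    ∃ c, ∀ v, GoodK K v π ↔ v ≤ c := by
  classical
  refine ⟨Nat.findGreatest (fun v => GoodK K v π) n, fun v => ⟨fun h => ?_, fun h => ?_⟩⟩
  · exact Nat.le_findGreatest h.1 h
  · exact goodK_mono K π (Nat.findGreatest_spec (P := fun v => GoodK K v π) (Nat.zero_le n) (goodK_zero K π)) h

noncomputable def label (K : ℕ) {n : ℕ} (π : Equiv.Perm (Fin n)) : ℕ := (exists_label K π).choose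

theorem label_spec (K : ℕ) {n : ℕ} (π : Equiv.Perm (Fin n)) (v : ℕ) :
    GoodK K v π ↔ v ≤ label K π := (exists_label K π).choose_spec v

theorem label_eq (K : ℕ) {n : ℕ} (π : Equiv.Perm (Fin n)) (c : ℕ) (h : ∀ v, GoodK K v π ↔ v ≤ c) :
    label K π = c := by
  apply le_antisymm
  · exact (h _).1 ((label_spec K π _).2 le_rfl)
  · exact (label_spec K π _).1 ((h _).2 le_rfl)

theorem goodK_ins_zero (K : ℕ) {n : ℕ} (π : Equiv.Perm (Fin n)) (w : ℕ) :
    GoodK K (w + 1) (insLast 0 π) ↔ GoodK K w π := by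
  have hv : ∀ i : Fin n, (insLast 0 π i.castSucc).val = (π i).val + 1 := by
    intro i; rw [insLast_val]; simp
  constructor
  · rintro ⟨h1, h2, h3⟩
    refine ⟨by omega, fun i j hij a b => ?_, fun q hq => ?_⟩
    · exact h2 i.castSucc j.castSucc (by simpa) ((insLast_lt ..).2 a) (by rw [hv]; omega)
    · have := h3 q.castSucc (by rw [hv]; omega)
      rw [card_castSucc] at this
      simpa only [hv, Nat.add_lt_add_iff_right] using this
  · rintro ⟨h1, h2, h3⟩
    refine ⟨by omega, fun i j => ?_, fun q => ?_⟩
    · refine Fin.lastCases ?_ (fun j => ?_) j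
      · simp [insLast_last]
      · intro hij
        obtain ⟨i, rfl⟩ : ∃ j', i = Fin.castSucc j' := Fin.exists_castSucc_eq.2 (hij.trans_le (Fin.le_last _)).ne |>.imp fun _ h => h.symm
        rw [insLast_lt, hv]
        intro a b
        exact h2 i j (by simpa using hij) a (by omega)
    · refine Fin.lastCases ?_ (fun q => ?_) q
      · simp [insLast_last]
      · rw [hv, card_castSucc]
        simp only [hv, Nat.add_lt_add_iff_right]
        exact fun a => h3 q (by omega)

theorem card_lt_val {n : ℕ} (π : Equiv.Perm (Fin n)) (w : ℕ) (hw : w ≤ n) :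
    (univ.filter fun i => (π i).val < w).card = w := by
  have : (univ.filter fun i => (π i).val < w) =
      (univ.filter fun i : Fin n => i.val < w).map π.symm.toEmbedding := by
    ext i
    simp
  rw [this, Finset.card_map, Fin.card_filter_val_lt]
  omega

theorem goodK_ins_pos (K : ℕ) {n : ℕ} (π : Equiv.Perm (Fin n)) (v : Fin (n + 1)) (hv : 1 ≤ v.val)
    (hg : GoodK K v.val π) (w : ℕ) :
    GoodK K w (insLast v π) ↔ w ≤ min v.val K := by
  obtain ⟨h1, h2, h3⟩ := hg
  have hlow : ∀ i : Fin n, w ≤ v.val → ((insLast v π i.castSucc).val < w ↔ (π i).val < w) := by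
    intro i hw
    rw [insLast_val]; split_ifs <;> omega
  constructor
  · rintro ⟨g1, g2, g3⟩
    have hwv : w ≤ v.val := by
      by_contra hc
      have hn : 0 < n := by omega
      refine g2 (π.symm ⟨0, hn⟩).castSucc (Fin.last n) (Fin.castSucc_lt_last _) ?_ ?_
      · rw [insLast_lt_last, Equiv.apply_symm_apply]; exact hv
      · rw [insLast_last]; omega
    refine le_min hwv ?_
    have := g3 (Fin.last n) (by rw [insLast_last]; exact hwv)
    rw [card_lastPos] at this
    simp only [hlow _ hwv] at this
    rwa [card_lt_val π w (by omega)] at this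
  · intro hw
    have hwv : w ≤ v.val := hw.trans (min_le_left _ _)
    have hwK : w ≤ K := hw.trans (min_le_right _ _)
    refine ⟨by omega, fun i j => ?_, fun q => ?_⟩
    · refine Fin.lastCases ?_ (fun j => ?_) j
      · rw [insLast_last]; intros; omega
      · intro hij
        obtain ⟨i, rfl⟩ : ∃ j', i = Fin.castSucc j' := Fin.exists_castSucc_eq.2 (hij.trans_le (Fin.le_last _)).ne |>.imp fun _ h => h.symm
        rw [insLast_lt, hlow _ hwv]
        intro a b
        exact h2 i j (by simpa using hij) a (by omega)
    · intro _
      refine le_trans ?_ hwK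
      conv_rhs => rw [← card_lt_val (insLast v π) w (by omega)]
      apply Finset.card_le_card
      intro i
      simp only [mem_filter, mem_univ, true_and]
      exact fun h => h.2

theorem label_ins_zero (K : ℕ) {n : ℕ} (π : Equiv.Perm (Fin n)) :
    label K (insLast 0 π) = label K π + 1 := by
  apply label_eq
  intro v
  cases v with
  | zero => simp [goodK_zero]
  | succ v => rw [goodK_ins_zero, label_spec]; omega

theorem label_ins_pos (K : ℕ) {n : ℕ} (π : Equiv.Perm (Fin n)) (v : Fin (n + 1)) (hv : 1 ≤ v.val)
    (hg : GoodK K v.val π) : label K (insLast v π) = min v.val K :=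
  label_eq _ _ _ (goodK_ins_pos K π v hv hg)

open Classical in
theorem sum_step (K n : ℕ) (g : ℕ → ℕ) :
    ∑ σ : Equiv.Perm (Fin (n + 1)), (if AvK K σ then g (label K σ) else 0) =
    ∑ π : Equiv.Perm (Fin n), (if AvK K π then
      g (label K π + 1) + ∑ p ∈ range (label K π), g (min (p + 1) K) else 0) := by
  rw [← (insLast_bij n).sum_comp (fun σ => if AvK K σ then g (label K σ) else 0),
    Fintype.sum_prod_type_right]
  apply Finset.sum_congr rfl
  intro π _
  simp only [avK_insLast]
  by_cases hA : AvK K π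
  · simp only [hA, true_and, if_true]
    rw [Fin.sum_univ_succ]
    congr 1
    · simp [goodK_zero, label_ins_zero]
    · have hl : label K π ≤ n := ((label_spec K π _).2 le_rfl).1
      have : ∀ i : Fin n, (if GoodK K (i.succ).val π then g (label K (insLast i.succ π)) else 0) =
          (fun p : ℕ => if p + 1 ≤ label K π then g (min (p + 1) K) else 0) i.val := by
        intro i
        by_cases h : GoodK K (i.succ).val π
        · have h' := (label_spec K π _).1 h
          rw [if_pos h, label_ins_pos K π _ (by simp) h]
          simp only [Fin.val_succ] at h' ⊢
          rw [if_pos h']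
        · have h' := mt (label_spec K π _).2 h
          rw [if_neg h]
          simp only [Fin.val_succ] at h' ⊢
          rw [if_neg h']
      rw [Finset.sum_congr rfl (fun i _ => this i), Fin.sum_univ_eq_sum_range
        (fun p : ℕ => if p + 1 ≤ label K π then g (min (p + 1) K) else 0) n, ← Finset.sum_filter]
      apply Finset.sum_congr _ (fun _ _ => rfl)
      ext p
      simp
      omega
  · simp [hA]

open Classical in
theorem sum_treeW (K n : ℕ) : ∀ m,
    ∑ σ : Equiv.Perm (Fin n), (if AvK K σ then treeW K m (label K σ) else 0) =
    treeW K (n + m) 0 := by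
  induction n with
  | zero =>
    intro m
    have h : ∀ σ : Equiv.Perm (Fin 0), AvK K σ := fun σ => ⟨fun i => i.elim0, fun i => i.elim0⟩
    have h0 : ∀ σ : Equiv.Perm (Fin 0), label K σ = 0 := fun σ =>
      Nat.le_zero.1 ((label_spec K σ _).2 le_rfl).1
    simp [h, h0]
  | succ n ih =>
    intro m
    rw [sum_step K n (treeW K m), show n + 1 + m = n + (m + 1) by omega, ← ih (m + 1)]
    rfl

theorem card_avoid (K n : ℕ) : Nat.card {π : Equiv.Perm (Fin n) //
    Avoids π p123 ∧ Avoids π (spat (K + 2))} = treeW K n 0 := by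
  classical
  simp only [avoids_iff]
  have := sum_treeW K n 0
  simp only [treeW] at this
  rw [Nat.card_eq_fintype_card, Fintype.card_subtype, Finset.card_filter]
  simpa using this

theorem stmt15 (k : ℕ) (hk : 4 ≤ k) :
    (PowerSeries.mk fun n => ((Nat.card {π : Equiv.Perm (Fin n) //
        Avoids π p123 ∧ Avoids π (spat k)} : ℕ) : ℤ)) *
      (1 - PowerSeries.X * PowerSeries.mk fun n => ((Nat.card {π : Equiv.Perm (Fin n) //
        Avoids π p123 ∧ Avoids π (spat (k - 1))} : ℕ) : ℤ)) = 1 := by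
  obtain ⟨K, rfl⟩ : ∃ K, k = K + 1 + 2 := ⟨k - 3, by omega⟩
  rw [show K + 1 + 2 - 1 = K + 2 by omega]
  simp only [card_avoid]
  exact treeF_rec (K + 1) (by omega)
end

section
/- For every natural number n, the number of permutations of {1,…,n} simultaneously avoiding the patterns 123, 2143 and 3214 equals the n-th Pell number p_n, where p_0 = p_1 = 1, p_2 = 2 and p_n = 2p_{n-1} + p_{n-2} for n ≥ 3. -/
/-- Pell numbers with `p 0 = p 1 = 1`, `p 2 = 2`. -/
def Pell : ℕ → ℕ
  | 0 => 1
  | 1 => 1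
  | 2 => 2
  | n + 3 => 2 * Pell (n + 2) + Pell (n + 1)

/-- Explicit form of avoidance of the three patterns. -/
def Good {n : ℕ} (σ : Equiv.Perm (Fin n)) : Prop :=
  (∀ a b c, a < b → b < c → σ a < σ b → σ b < σ c → False) ∧
  (∀ a b c d, a < b → b < c → c < d → σ b < σ a → σ a < σ d → σ d < σ c → False) ∧
  (∀ a b c d, a < b → b < c → c < d → σ c < σ b → σ b < σ a → σ a < σ d → False)

theorem contains123 {n : ℕ} (σ : Equiv.Perm (Fin n)) : Contains σ p123 ↔
    ∃ a b c, a < b ∧ b < c ∧ σ a < σ b ∧ σ b < σ c := by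
  constructor
  · rintro ⟨f, hf, h⟩
    exact ⟨f 0, f 1, f 2, hf (by decide), hf (by decide),
      (h _ _).2 (by decide), (h _ _).2 (by decide)⟩
  · rintro ⟨a, b, c, h1, h2, h3, h4⟩
    refine ⟨![a, b, c], ?_, ?_⟩
    · intro x y hxy
      fin_cases x <;> fin_cases y <;> simp at hxy ⊢ <;> omega
    · intro x y
      fin_cases x <;> fin_cases y <;> simp [p123] <;> omega

theorem contains2143 {n : ℕ} (σ : Equiv.Perm (Fin n)) : Contains σ p2143 ↔
    ∃ a b c d, a < b ∧ b < c ∧ c < d ∧ σ b < σ a ∧ σ a < σ d ∧ σ d < σ c := by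
  constructor
  · rintro ⟨f, hf, h⟩
    exact ⟨f 0, f 1, f 2, f 3, hf (by decide), hf (by decide), hf (by decide),
      (h _ _).2 (by decide), (h _ _).2 (by decide), (h _ _).2 (by decide)⟩
  · rintro ⟨a, b, c, d, h1, h2, h3, h4, h5, h6⟩
    refine ⟨![a, b, c, d], ?_, ?_⟩
    · intro x y hxy
      fin_cases x <;> fin_cases y <;> simp at hxy ⊢ <;> omega
    · intro x y
      fin_cases x <;> fin_cases y <;> simp [p2143] <;> omega

theorem contains3214 {n : ℕ} (σ : Equiv.Perm (Fin n)) : Contains σ p3214 ↔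
    ∃ a b c d, a < b ∧ b < c ∧ c < d ∧ σ c < σ b ∧ σ b < σ a ∧ σ a < σ d := by
  constructor
  · rintro ⟨f, hf, h⟩
    exact ⟨f 0, f 1, f 2, f 3, hf (by decide), hf (by decide), hf (by decide),
      (h _ _).2 (by decide), (h _ _).2 (by decide), (h _ _).2 (by decide)⟩
  · rintro ⟨a, b, c, d, h1, h2, h3, h4, h5, h6⟩
    refine ⟨![a, b, c, d], ?_, ?_⟩
    · intro x y hxy
      fin_cases x <;> fin_cases y <;> simp at hxy ⊢ <;> omega
    · intro x y
      fin_cases x <;> fin_cases y <;> simp [p3214] <;> omega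

theorem good_iff {n : ℕ} (σ : Equiv.Perm (Fin n)) :
    (Avoids σ p123 ∧ Avoids σ p2143 ∧ Avoids σ p3214) ↔ Good σ := by
  simp only [Avoids, contains123, contains2143, contains3214, Good, not_exists, not_and]

/-- Insert the maximal value at position `i`. -/
def ins {n : ℕ} (i : Fin (n + 1)) (τ : Equiv.Perm (Fin n)) : Equiv.Perm (Fin (n + 1)) :=
  ((finSuccEquiv' i).trans (Equiv.optionCongr τ)).trans (finSuccEquiv' (Fin.last n)).symm

theorem ins_self {n : ℕ} (i : Fin (n + 1)) (τ : Equiv.Perm (Fin n)) :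
    ins i τ i = Fin.last n := by
  simp [ins]

theorem ins_succAbove {n : ℕ} (i : Fin (n + 1)) (τ : Equiv.Perm (Fin n)) (j : Fin n) :
    ins i τ (i.succAbove j) = (τ j).castSucc := by
  simp [ins]

theorem ins_injective {n : ℕ} (i : Fin (n + 1)) : Function.Injective (ins i) := by
  intro τ τ' h
  ext j
  have := congrArg (fun e : Equiv.Perm (Fin (n + 1)) => e (i.succAbove j)) h
  simp only [ins_succAbove] at this
  exact congrArg Fin.val (Fin.castSucc_injective _ this)

theorem exists_ins {n : ℕ} (i : Fin (n + 1)) (σ : Equiv.Perm (Fin (n + 1)))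
    (h : σ i = Fin.last n) : ∃ τ, σ = ins i τ := by
  have key : ∀ j, ∃ k : Fin n, σ (i.succAbove j) = k.castSucc := by
    intro j
    have : σ (i.succAbove j) ≠ Fin.last n := by
      rw [← h]
      exact fun e => Fin.succAbove_ne i j (σ.injective e)
    exact ⟨_, (Fin.castSucc_castPred _ this).symm⟩
  choose f hf using key
  have hinj : Function.Injective f := by
    intro a b hab
    apply Fin.succAbove_right_injective (p := i)
    apply σ.injective
    rw [hf, hf, hab]
  refine ⟨Equiv.ofBijective f (Finite.injective_iff_bijective.1 hinj), ?_⟩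
  ext x : 1
  rcases Fin.eq_self_or_eq_succAbove i x with rfl | ⟨j, rfl⟩
  · rw [ins_self, h]
  · rw [ins_succAbove, hf]; rfl

theorem good_of_ins {n : ℕ} {i : Fin (n + 1)} {τ : Equiv.Perm (Fin n)}
    (h : Good (ins i τ)) : Good τ := by
  obtain ⟨h1, h2, h3⟩ := h
  have m : StrictMono i.succAbove := Fin.strictMono_succAbove i
  refine ⟨fun a b c ab bc => ?_, fun a b c d ab bc cd => ?_, fun a b c d ab bc cd => ?_⟩
  · simpa [ins_succAbove] using h1 _ _ _ (m ab) (m bc)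
  · simpa [ins_succAbove] using h2 _ _ _ _ (m ab) (m bc) (m cd)
  · simpa [ins_succAbove] using h3 _ _ _ _ (m ab) (m bc) (m cd)

/-- Only occurrences using the inserted maximum need to be excluded. -/
theorem good_ins {n : ℕ} {i : Fin (n + 1)} {τ : Equiv.Perm (Fin n)} (h : Good τ)
    (g1 : ∀ a b, a < b → b < i → ins i τ a < ins i τ b → False)
    (g2 : ∀ a b d, a < b → b < i → i < d → ins i τ b < ins i τ a → ins i τ a < ins i τ d → False)
    (g3 : ∀ a b c, a < b → b < c → c < i → ins i τ c < ins i τ b → ins i τ b < ins i τ a → False) :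
    Good (ins i τ) := by
  obtain ⟨h1, h2, h3⟩ := h
  have m : StrictMono i.succAbove := Fin.strictMono_succAbove i
  have key : ∀ x y, ins i τ x < ins i τ y → ∃ j, x = i.succAbove j := by
    intro x y hxy
    rcases Fin.eq_self_or_eq_succAbove i x with rfl | h
    · rw [ins_self] at hxy
      exact absurd hxy (not_lt.2 (Fin.le_last _))
    · exact h
  refine ⟨fun a b c ab bc h4 h5 => ?_, fun a b c d ab bc cd h4 h5 h6 => ?_,
    fun a b c d ab bc cd h4 h5 h6 => ?_⟩
  · rcases Fin.eq_self_or_eq_succAbove i c with rfl | ⟨c, rfl⟩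
    · exact g1 a b ab bc h4
    obtain ⟨a, rfl⟩ := key _ _ h4
    obtain ⟨b, rfl⟩ := key _ _ h5
    simp only [ins_succAbove, Fin.castSucc_lt_castSucc_iff] at h4 h5
    exact h1 a b c (m.lt_iff_lt.1 ab) (m.lt_iff_lt.1 bc) h4 h5
  · rcases Fin.eq_self_or_eq_succAbove i c with rfl | ⟨c, rfl⟩
    · exact g2 a b d ab bc cd h4 h5
    obtain ⟨b, rfl⟩ := key _ _ h4
    obtain ⟨a, rfl⟩ := key _ _ h5
    obtain ⟨d, rfl⟩ := key _ _ h6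
    simp only [ins_succAbove, Fin.castSucc_lt_castSucc_iff] at h4 h5 h6
    exact h2 a b c d (m.lt_iff_lt.1 ab) (m.lt_iff_lt.1 bc) (m.lt_iff_lt.1 cd) h4 h5 h6
  · rcases Fin.eq_self_or_eq_succAbove i d with rfl | ⟨d, rfl⟩
    · exact g3 a b c ab bc cd h4 h5
    obtain ⟨c, rfl⟩ := key _ _ h4
    obtain ⟨b, rfl⟩ := key _ _ h5
    obtain ⟨a, rfl⟩ := key _ _ h6
    simp only [ins_succAbove, Fin.castSucc_lt_castSucc_iff] at h4 h5 h6
    exact h3 a b c d (m.lt_iff_lt.1 ab) (m.lt_iff_lt.1 bc) (m.lt_iff_lt.1 cd) h4 h5 h6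

theorem good_ins_low {n : ℕ} {i : Fin (n + 1)} (hi : i.val ≤ 1) {τ : Equiv.Perm (Fin n)}
    (h : Good τ) : Good (ins i τ) := by
  refine good_ins h ?_ ?_ ?_
  · intro a b ab bi; omega
  · intro a b d ab bi; omega
  · intro a b c ab bc ci; omega

theorem ins_two_zero {n : ℕ} (τ : Equiv.Perm (Fin (n + 2))) :
    ins 2 τ 0 = (τ 0).castSucc := by
  rw [← ins_succAbove 2]
  congr 1

theorem ins_two_one {n : ℕ} (τ : Equiv.Perm (Fin (n + 2))) :
    ins 2 τ 1 = (τ 1).castSucc := by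
  rw [← ins_succAbove 2]
  congr 1

theorem val_two {n : ℕ} : (2 : Fin (n + 3)).val = 2 := rfl

theorem good_ins_two {n : ℕ} {τ : Equiv.Perm (Fin (n + 2))}
    (h : Good τ) (h0 : τ 0 = Fin.last _) : Good (ins 2 τ) := by
  have v2 := val_two (n := n)
  have z : ∀ a : Fin (n + 3), a.val = 0 → a = 0 := fun a ha => Fin.ext ha
  refine good_ins h ?_ ?_ ?_
  · intro a b ab bi hab
    obtain rfl := z a (by omega)
    have hb : b = 1 := Fin.ext (show b.val = 1 by omega)
    subst hb
    rw [ins_two_zero, ins_two_one, h0, Fin.castSucc_lt_castSucc_iff] at hab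
    exact absurd hab (not_lt.2 (Fin.le_last _))
  · intro a b d ab bi id _ had
    obtain rfl := z a (by omega)
    obtain ⟨d, rfl⟩ := (Fin.eq_self_or_eq_succAbove 2 d).resolve_left (by omega)
    rw [ins_two_zero, ins_succAbove, h0, Fin.castSucc_lt_castSucc_iff] at had
    exact absurd had (not_lt.2 (Fin.le_last _))
  · intro a b c ab bc ci; omega

theorem first_of_good_ins_two {n : ℕ} {τ : Equiv.Perm (Fin (n + 2))}
    (h : Good (ins 2 τ)) : τ 0 = Fin.last _ := by
  obtain ⟨h1, h2, h3⟩ := h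
  by_contra hne
  obtain ⟨c, hc⟩ := τ.surjective (Fin.last _)
  have hlt : τ 0 < τ c := by rw [hc]; exact Fin.lt_last_iff_ne_last.2 hne
  have v2 := val_two (n := n)
  have l01 : (0 : Fin (n + 3)) < 1 := Nat.zero_lt_one
  have l12 : (1 : Fin (n + 3)) < 2 := Nat.one_lt_two
  have t01 : τ 1 < τ 0 := by
    by_contra hn
    have : τ 0 ≠ τ 1 := fun e => by
      have := congrArg Fin.val (τ.injective e)
      exact absurd this (by simp)
    refine h1 0 1 2 l01 l12 ?_ ?_
    · rw [ins_two_zero, ins_two_one, Fin.castSucc_lt_castSucc_iff]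
      exact lt_of_le_of_ne (not_lt.1 hn) this
    · rw [ins_two_one, ins_self]; exact Fin.castSucc_lt_last _
  have c0 : c.val ≠ 0 := fun e => by
    have : c = 0 := Fin.ext e
    subst this; exact lt_irrefl _ hlt
  have c1 : c.val ≠ 1 := fun e => by
    have : c = 1 := Fin.ext e
    subst this; exact lt_asymm hlt t01
  have hpos : (2 : Fin (n + 3)) < (2 : Fin (n + 3)).succAbove c := by
    rw [Fin.succAbove_of_le_castSucc]
    · rw [Fin.lt_def, v2, Fin.val_succ]; omega
    · rw [Fin.le_def, v2, Fin.val_castSucc]; omega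
  refine h2 0 1 2 _ l01 l12 hpos ?_ ?_ ?_
  · rw [ins_two_zero, ins_two_one, Fin.castSucc_lt_castSucc_iff]; exact t01
  · rw [ins_two_zero, ins_succAbove, Fin.castSucc_lt_castSucc_iff]; exact hlt
  · rw [ins_succAbove, ins_self]; exact Fin.castSucc_lt_last _

theorem pos_of_good {n : ℕ} {σ : Equiv.Perm (Fin (n + 3))} (h : Good σ) :
    σ 0 = Fin.last _ ∨ σ 1 = Fin.last _ ∨ σ 2 = Fin.last _ := by
  obtain ⟨h1, h2, h3⟩ := h
  obtain ⟨c, hc⟩ := σ.surjective (Fin.last _)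
  by_contra! hne
  obtain ⟨n0, n1, n2⟩ := hne
  have v2 := val_two (n := n)
  have l01 : (0 : Fin (n + 3)) < 1 := Nat.zero_lt_one
  have l12 : (1 : Fin (n + 3)) < 2 := Nat.one_lt_two
  have m : ∀ x, σ x ≠ Fin.last _ → σ x < σ c := by
    intro x hx; rw [hc]; exact Fin.lt_last_iff_ne_last.2 hx
  have e0 : c.val ≠ 0 := fun e => n0 (by rw [← hc]; congr 1; exact Fin.ext e.symm)
  have e1 : c.val ≠ 1 := fun e => n1 (by rw [← hc]; congr 1; exact Fin.ext e.symm)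
  have e2 : c.val ≠ 2 := fun e => n2 (by rw [← hc]; congr 1; exact Fin.ext e.symm)
  have l2c : (2 : Fin (n + 3)) < c := by rw [Fin.lt_def]; omega
  have l1c := l12.trans l2c
  refine h3 0 1 2 c l01 l12 l2c ?_ ?_ (m _ n0)
  · by_contra hn
    exact h1 1 2 c l12 l2c (lt_of_le_of_ne (not_lt.1 hn) (fun e => l12.ne (σ.injective e))) (m _ n2)
  · by_contra hn
    exact h1 0 1 c l01 l1c (lt_of_le_of_ne (not_lt.1 hn) (fun e => l01.ne (σ.injective e))) (m _ n1)

theorem good_decomp (n : ℕ) : {σ : Equiv.Perm (Fin (n + 3)) | Good σ} =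
    ins 0 '' {τ | Good τ} ∪ (ins 1 '' {τ | Good τ} ∪ ins 2 '' (ins 0 '' {τ | Good τ})) := by
  ext σ
  constructor
  · intro h
    rcases pos_of_good h with h0 | h0 | h0
    · obtain ⟨τ, rfl⟩ := exists_ins _ _ h0
      exact Or.inl ⟨τ, good_of_ins h, rfl⟩
    · obtain ⟨τ, rfl⟩ := exists_ins _ _ h0
      exact Or.inr (Or.inl ⟨τ, good_of_ins h, rfl⟩)
    · obtain ⟨τ, rfl⟩ := exists_ins _ _ h0
      have h' := good_of_ins h
      obtain ⟨ρ, rfl⟩ := exists_ins _ _ (first_of_good_ins_two h)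
      exact Or.inr (Or.inr ⟨_, ⟨ρ, good_of_ins h', rfl⟩, rfl⟩)
  · rintro (⟨τ, h, rfl⟩ | ⟨τ, h, rfl⟩ | ⟨_, ⟨ρ, h, rfl⟩, rfl⟩)
    · exact good_ins_low (by simp) h
    · exact good_ins_low (by simp) h
    · exact good_ins_two (good_ins_low (by simp) h) (ins_self _ _)

theorem ins_disjoint {n : ℕ} {i j : Fin (n + 1)} (hij : i ≠ j)
    (A B : Set (Equiv.Perm (Fin n))) : Disjoint (ins i '' A) (ins j '' B) := by
  rw [Set.disjoint_left]
  rintro _ ⟨a, _, rfl⟩ ⟨b, _, hb⟩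
  apply hij
  apply (ins i a).injective
  rw [ins_self, ← hb, ins_self]

theorem good_rec (n : ℕ) : {σ : Equiv.Perm (Fin (n + 3)) | Good σ}.ncard =
    2 * {σ : Equiv.Perm (Fin (n + 2)) | Good σ}.ncard +
      {σ : Equiv.Perm (Fin (n + 1)) | Good σ}.ncard := by
  have l01 : (0 : Fin (n + 3)) < 1 := Nat.zero_lt_one
  have l12 : (1 : Fin (n + 3)) < 2 := Nat.one_lt_two
  rw [good_decomp, Set.ncard_union_eq, Set.ncard_union_eq,
    Set.ncard_image_of_injective _ (ins_injective _),
    Set.ncard_image_of_injective _ (ins_injective _),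
    Set.ncard_image_of_injective _ (ins_injective _),
    Set.ncard_image_of_injective _ (ins_injective _)]
  · ring
  · exact ins_disjoint l12.ne _ _
  · exact (ins_disjoint l01.ne _ _).union_right (ins_disjoint (l01.trans l12).ne _ _)

theorem good_small {n : ℕ} (hn : n ≤ 2) : {σ : Equiv.Perm (Fin n) | Good σ}.ncard = n.factorial := by
  have : {σ : Equiv.Perm (Fin n) | Good σ} = Set.univ := by
    ext σ
    simp only [Set.mem_ofPred_eq, Set.mem_univ, iff_true]
    refine ⟨?_, ?_, ?_⟩
    · intro a b c ab bc; omega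
    · intro a b c d ab bc; omega
    · intro a b c d ab bc; omega
  rw [this, Set.ncard_univ, Nat.card_eq_fintype_card, Fintype.card_perm, Fintype.card_fin]

theorem good_card (n : ℕ) : {σ : Equiv.Perm (Fin n) | Good σ}.ncard = Pell n := by
  induction n using Pell.induct with
  | case1 => exact good_small (by norm_num)
  | case2 => exact good_small (by norm_num)
  | case3 => exact good_small (by norm_num)
  | case4 n h1 h2 => rw [good_rec, h1, h2, Pell]

theorem stmt16 (n : ℕ) :
    Nat.card {σ : Equiv.Perm (Fin n) //
      Avoids σ p123 ∧ Avoids σ p2143 ∧ Avoids σ p3214} = Pell n := by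
  simp only [good_iff]
  exact good_card n
end
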